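/- arXiv:2008.12440 — 10 statements merged into one kernel-verified Lean document; each statement's English description precedes it below -/
import Mathlib

section
/- Let p ∈ ℝ[X] be a polynomial of degree n ≥ 1 with leading coefficient p_n ≠ 0, and regard the δ-perturbed polynomial as the element P = p(X) − T of (ℝ[T])[X], whose constant coefficient is p_0 − T and whose other coefficients are the constants p_1, …, p_n. Then the resultant Res_{n, n−1}(P, ∂P/∂X) is an element of ℝ[T] of degree at most n − 1 in T; consequently the discriminant Dis(P) = (−1)^{n(n−1)/2} p_n^{−1} Res_{n, n−1}(P, ∂P/∂X) (the 'hidden polynomial') is a polynomial in T of degree at most n − 1. -/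
open Polynomial

/-- The `(d+e) × (d+e)` Sylvester matrix of `F` (regarded as a polynomial of degree at most `d`)
and `G` (regarded as a polynomial of degree at most `e`): the first `e` rows are the shifted
coefficient vectors of `F` and the last `d` rows are the shifted coefficient vectors of `G`. -/
noncomputable def sylvesterMatrix {R : Type*} [CommRing R] (d e : ℕ) (F G : Polynomial R) :
    Matrix (Fin (e + d)) (Fin (e + d)) R :=
  Matrix.of fun i j =>
    if (i : ℕ) < e then
      if (i : ℕ) ≤ (j : ℕ) ∧ (j : ℕ) ≤ d + (i : ℕ) then F.coeff (d + (i : ℕ) - (j : ℕ)) else 0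
    else
      if (i : ℕ) - e ≤ (j : ℕ) ∧ (j : ℕ) ≤ e + ((i : ℕ) - e) then
        G.coeff (e + ((i : ℕ) - e) - (j : ℕ)) else 0

/-- The resultant `Res_{d,e}(F, G)`, the determinant of the Sylvester matrix. -/
noncomputable def resultantAux {R : Type*} [CommRing R] (d e : ℕ) (F G : Polynomial R) : R :=
  (sylvesterMatrix d e F G).det

/-- The δ-perturbed polynomial `p(X) - T`, as an element of `(ℝ[T])[X]`: its constant
coefficient is `p₀ - T` and its other coefficients are the constants `p₁, …, pₙ`. -/
noncomputable def perturbed (p : Polynomial ℝ) : Polynomial (Polynomial ℝ) :=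
  p.map (C : ℝ →+* Polynomial ℝ) - C (X : Polynomial ℝ)

/-- The `T`-degree of a determinant is at most the sum of the row degree bounds. -/
lemma natDegree_det_le_sum_rows {m : ℕ} (M : Matrix (Fin m) (Fin m) (Polynomial ℝ))
    (w : Fin m → ℕ) (hw : ∀ i j, (M i j).natDegree ≤ w i) :
    M.det.natDegree ≤ ∑ i, w i := by
  rw [Matrix.det_apply']
  refine natDegree_sum_le_of_forall_le _ _ fun σ _ => ?_
  rw [← Equiv.sum_comp σ w]
  have h1 : (((Equiv.Perm.sign σ : ℤ) : Polynomial ℝ)).natDegree = 0 := natDegree_intCast _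
  refine natDegree_mul_le.trans ?_
  rw [h1, zero_add]
  exact (natDegree_prod_le _ _).trans (Finset.sum_le_sum fun i _ => hw _ _)

lemma natDegree_coeff_perturbed_le (p : Polynomial ℝ) (k : ℕ) :
    ((perturbed p).coeff k).natDegree ≤ 1 := by
  unfold perturbed
  rw [coeff_sub, coeff_map, coeff_C]
  refine (natDegree_sub_le _ _).trans ?_
  split_ifs <;> simp

lemma natDegree_coeff_derivative_perturbed (p : Polynomial ℝ) (k : ℕ) :
    ((derivative (perturbed p)).coeff k).natDegree = 0 := by
  have h : derivative (perturbed p) = (derivative p).map C := by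
    simp [perturbed, derivative_map]
  rw [h, coeff_map, natDegree_C]

lemma natDegree_resultantAux_perturbed_le (d e : ℕ) (p : Polynomial ℝ) :
    (resultantAux d e (perturbed p) (derivative (perturbed p))).natDegree ≤ e := by
  refine (natDegree_det_le_sum_rows _ (fun i => if (i : ℕ) < e then 1 else 0) ?_).trans ?_
  · intro i j
    unfold sylvesterMatrix
    rw [Matrix.of_apply]
    split_ifs
    · exact natDegree_coeff_perturbed_le _ _
    · simp
    · exact (natDegree_coeff_derivative_perturbed _ _).le
    · simp
  · rw [Fin.sum_univ_add]
    simp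

/-- **Hidden equation of threshold risk, constant perturbation.**
For `p ∈ ℝ[X]` of degree `n ≥ 1` with leading coefficient `pₙ ≠ 0`, the resultant
`Res_{n,n-1}(P, ∂P/∂X)` of the perturbed polynomial `P = p(X) - T` is a polynomial in `T`
of degree at most `n - 1`; consequently the discriminant
`Dis(P) = (-1)^(n(n-1)/2) pₙ⁻¹ Res_{n,n-1}(P, ∂P/∂X)` (the "hidden polynomial")
is a polynomial in `T` of degree at most `n - 1`. -/
theorem hidden_polynomial_degree_constant_perturbation
    (n : ℕ) (hn : 1 ≤ n) (p : Polynomial ℝ) (hdeg : p.natDegree = n)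
    (hlead : p.coeff n ≠ 0) :
    (resultantAux n (n - 1) (perturbed p) (derivative (perturbed p))).natDegree ≤ n - 1 ∧
    ((-1 : Polynomial ℝ) ^ (n * (n - 1) / 2) * C (p.coeff n)⁻¹ *
        resultantAux n (n - 1) (perturbed p) (derivative (perturbed p))).natDegree ≤ n - 1 := by
  have h := natDegree_resultantAux_perturbed_le n (n - 1) p
  refine ⟨h, ?_⟩
  refine natDegree_mul_le.trans ?_
  have h2 : ((-1 : Polynomial ℝ) ^ (n * (n - 1) / 2) * C (p.coeff n)⁻¹).natDegree = 0 := by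
    have h3 : (-1 : Polynomial ℝ) ^ (n * (n - 1) / 2) * C (p.coeff n)⁻¹
        = C ((-1) ^ (n * (n - 1) / 2) * (p.coeff n)⁻¹) := by simp
    rw [h3, natDegree_C]
  omega
end

section
/- If δ₀ ∈ ℝ is a risk critical point of the threshold risk function R, then the polynomial p − δ₀ has a repeated root in ℂ; that is, there exists z ∈ ℂ with p(z) = δ₀ and p'(z) = 0 (equivalently, δ₀ lies in the zero set of the discriminant of the δ-perturbed polynomial p − δ). -/
open Polynomial MeasureTheory

/-- The threshold risk function `R(δ) = μ({x : p(x) < δ})`, where `μ` is the Borel measure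
on `ℝ` with density `f` with respect to Lebesgue measure. -/
noncomputable def thresholdRisk (f : ℝ → ℝ) (p : Polynomial ℝ) (δ : ℝ) : ℝ :=
  ((volume.withDensity fun x => ENNReal.ofReal (f x)) {x : ℝ | p.eval x < δ}).toReal

/-- `δ₀` is a risk critical point of `R` if there is no neighbourhood `N` of `δ₀` on which the
difference quotients `|R(δ) - R(δ₀)|/|δ - δ₀|`, `δ ∈ N \ {δ₀}`, are uniformly bounded. -/
def IsRiskCriticalPoint (R : ℝ → ℝ) (δ₀ : ℝ) : Prop :=
  ¬ ∃ N ∈ nhds δ₀, ∃ C : ℝ, ∀ δ ∈ N, δ ≠ δ₀ → |R δ - R δ₀| / |δ - δ₀| ≤ C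

open Filter Topology in
/-- Linear bound for the measure of small sublevel sets, near any point that is not a repeated root. -/
lemma sublevel_local (μ : Measure ℝ) [IsProbabilityMeasure μ] (f : ℝ → ℝ) (hf : Continuous f)
    (hμ : μ = volume.withDensity fun x => ENNReal.ofReal (f x)) (q : Polynomial ℝ) (x : ℝ)
    (hq : q.eval x = 0 → (derivative q).eval x ≠ 0) :
    ∃ t ∈ 𝓝 x, ∃ C : ℝ, ∀ ε > 0, μ.real (t ∩ {y | |q.eval y| ≤ ε}) ≤ C * ε := by
  by_cases h0 : q.eval x = 0
  · obtain ⟨h, rfl⟩ := dvd_iff_isRoot.mpr h0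
    have hx : h.eval x ≠ 0 := by simpa using hq h0
    have hc : 0 < |h.eval x| / 2 := by positivity
    have e1 : ∀ᶠ y in 𝓝 x, |h.eval x| / 2 < |h.eval y| :=
      (h.continuous.abs.tendsto x).eventually_const_lt (by linarith)
    have e2 : ∀ᶠ y in 𝓝 x, f y < |f x| + 1 :=
      (hf.tendsto x).eventually_lt_const (by linarith [le_abs_self (f x)])
    obtain ⟨t, ht, hto, hxt⟩ := eventually_nhds_iff.mp (e1.and e2)
    set c := |h.eval x| / 2
    set M := |f x| + 1
    have hM : 0 < M := by positivity
    refine ⟨t, hto.mem_nhds hxt, M * (2 / c), fun ε hε => ?_⟩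
    have hsub : t ∩ {y | |eval y ((X - C x) * h)| ≤ ε} ⊆ Metric.closedBall x (ε / c) ∩ t := by
      rintro y ⟨hy, hy2⟩
      refine ⟨?_, hy⟩
      simp only [Set.mem_setOf_eq, eval_mul, eval_sub, eval_X, eval_C, abs_mul] at hy2
      rw [Metric.mem_closedBall, Real.dist_eq, le_div_iff₀ hc]
      refine le_trans ?_ hy2
      gcongr
      exact (ht y hy).1.le
    refine (measureReal_mono hsub).trans ?_
    have hms : MeasurableSet (Metric.closedBall x (ε / c) ∩ t) :=
      Metric.isClosed_closedBall.measurableSet.inter hto.measurableSet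
    have : μ (Metric.closedBall x (ε / c) ∩ t) ≤ ENNReal.ofReal (M * (2 / c) * ε) := by
      rw [hμ, withDensity_apply _ hms]
      calc _ ≤ ∫⁻ _ in Metric.closedBall x (ε / c) ∩ t, ENNReal.ofReal M :=
            setLIntegral_mono' hms fun y hy => ENNReal.ofReal_le_ofReal (ht y hy.2).2.le
        _ = ENNReal.ofReal M * volume (Metric.closedBall x (ε / c) ∩ t) := by simp
        _ ≤ ENNReal.ofReal M * volume (Metric.closedBall x (ε / c)) := by
            gcongr
            exact Set.inter_subset_left
        _ = _ := by
            rw [Real.volume_closedBall, ← ENNReal.ofReal_mul hM.le]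
            congr 1
            ring
    exact ENNReal.toReal_le_of_le_ofReal (by positivity) this
  · have hc : 0 < |q.eval x| / 2 := by positivity
    have e1 : ∀ᶠ y in 𝓝 x, |q.eval x| / 2 < |q.eval y| :=
      (q.continuous.abs.tendsto x).eventually_const_lt (by linarith)
    refine ⟨_, e1, 1 / (|q.eval x| / 2), fun ε hε => ?_⟩
    by_cases h : ε < |q.eval x| / 2
    · have : {y | |q.eval x| / 2 < |q.eval y|} ∩ {y | |q.eval y| ≤ ε} = ∅ := by
        ext y
        simp only [Set.mem_inter_iff, Set.mem_setOf_eq, Set.mem_empty_iff_false, iff_false]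
        rintro ⟨h1, h2⟩
        linarith
      rw [this, measureReal_empty]
      positivity
    · refine measureReal_le_one.trans ?_
      rw [one_div, ← div_eq_inv_mul, le_div_iff₀ hc]
      linarith

/-- If `δ₀` is a risk critical point of the threshold risk function, then the polynomial
`p - δ₀` has a repeated root in `ℂ`: there is `z ∈ ℂ` with `p(z) = δ₀` and `p'(z) = 0`. -/
theorem riskCriticalPoint_mem_discriminant_zero_set
    (p : Polynomial ℝ) (hp : 1 ≤ p.natDegree)
    (f : ℝ → ℝ) (hf_cont : Continuous f) (hf_nonneg : ∀ x, 0 ≤ f x)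
    (hf_int : ∫ x : ℝ, f x = 1)
    (δ₀ : ℝ) (hcrit : IsRiskCriticalPoint (thresholdRisk f p) δ₀) :
    ∃ z : ℂ, aeval z p = (δ₀ : ℂ) ∧ aeval z (derivative p) = 0 := by
  by_contra hno
  apply hcrit
  have hInt : Integrable f := by
    by_contra h
    rw [integral_undef h] at hf_int
    exact zero_ne_one hf_int
  set μ : Measure ℝ := volume.withDensity fun x => ENNReal.ofReal (f x) with hμ
  have : IsProbabilityMeasure μ := by
    constructor
    rw [hμ, withDensity_apply _ MeasurableSet.univ, setLIntegral_univ,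
      ← ofReal_integral_eq_lintegral_ofReal hInt (Filter.Eventually.of_forall hf_nonneg), hf_int,
      ENNReal.ofReal_one]
  set q : Polynomial ℝ := p - C δ₀ with hq
  have hqe : ∀ x, q.eval x = p.eval x - δ₀ := fun x => by simp [hq]
  have hqd : 0 < q.degree := by
    rw [hq, ← natDegree_pos_iff_degree_pos, natDegree_sub_C]
    exact hp
  have hsimple : ∀ x, q.eval x = 0 → (derivative q).eval x ≠ 0 := by
    intro x h1 h2
    have h3 : (derivative p).eval x = 0 := by simpa [hq] using h2
    have h4 : p.eval x = δ₀ := by linarith [hqe x]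
    refine hno ⟨(x : ℂ), ?_, ?_⟩
    · rw [← h4]
      exact aeval_algebraMap_apply_eq_algebraMap_eval x p
    · have := aeval_algebraMap_apply_eq_algebraMap_eval (A := ℂ) x (derivative p)
      rw [h3, map_zero] at this
      exact this
  have htend := q.tendsto_norm_atTop hqd (tendsto_norm_cocompact_atTop (E := ℝ))
  obtain ⟨K, hK, hKs⟩ := Filter.mem_cocompact.mp (htend.eventually (Filter.eventually_gt_atTop 1))
  obtain ⟨C, hC⟩ : ∃ C : ℝ, ∀ ε > 0, μ.real (K ∩ {y | |q.eval y| ≤ ε}) ≤ C * ε := by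
    refine hK.induction_on (p := fun s => ∃ C : ℝ, ∀ ε > 0,
      μ.real (s ∩ {y | |q.eval y| ≤ ε}) ≤ C * ε) ⟨0, by simp⟩ ?_ ?_ ?_
    · rintro s t hst ⟨C, hC⟩
      exact ⟨C, fun ε hε => (measureReal_mono (Set.inter_subset_inter_left _ hst)).trans (hC ε hε)⟩
    · rintro s t ⟨C, hC⟩ ⟨D, hD⟩
      refine ⟨C + D, fun ε hε => ?_⟩
      rw [Set.union_inter_distrib_right, add_mul]
      exact (measureReal_union_le _ _).trans (add_le_add (hC ε hε) (hD ε hε))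
    · intro x _
      obtain ⟨t, ht, h⟩ := sublevel_local μ f hf_cont hμ q x (hsimple x)
      exact ⟨t, mem_nhdsWithin_of_mem_nhds ht, h⟩
  have hdiff : ∀ a b ε : ℝ, 0 < ε → ε ≤ 1 →
      (∀ y, p.eval y < a → ¬ p.eval y < b → |q.eval y| ≤ ε) →
      thresholdRisk f p a - thresholdRisk f p b ≤ C * ε := by
    intro a b ε h0 h1 hab
    change μ.real {x | p.eval x < a} - μ.real {x | p.eval x < b} ≤ C * ε
    have hsub : {x | p.eval x < a} ⊆ {x | p.eval x < b} ∪ (K ∩ {y | |q.eval y| ≤ ε}) := by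
      intro y hy
      by_cases hb : p.eval y < b
      · exact Or.inl hb
      · have hle := hab y hy hb
        refine Or.inr ⟨?_, hle⟩
        by_contra hyK
        have h2 : 1 < ‖q.eval y‖ := hKs hyK
        rw [Real.norm_eq_abs] at h2
        linarith
    have h2 := (measureReal_mono (μ := μ) hsub).trans (measureReal_union_le _ _)
    linarith [hC ε h0]
  refine ⟨Metric.closedBall δ₀ 1, Metric.closedBall_mem_nhds _ one_pos, C, fun δ hδ hne => ?_⟩
  have hpos : 0 < |δ - δ₀| := abs_pos.mpr (sub_ne_zero.mpr hne)
  have h1 : |δ - δ₀| ≤ 1 := by simpa [Real.dist_eq] using hδ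
  rw [div_le_iff₀ hpos, abs_sub_le_iff]
  constructor
  · refine hdiff _ _ _ hpos h1 fun y ha hb => ?_
    rw [hqe, abs_of_nonneg (by linarith)]
    exact le_trans (by linarith) (le_abs_self _)
  · refine hdiff _ _ _ hpos h1 fun y ha hb => ?_
    rw [hqe, abs_of_nonpos (by linarith)]
    exact le_trans (by linarith) (neg_le_abs _)
end

section
/- The set of risk critical points of the threshold risk function R is finite and has at most n − 1 elements, where n is the degree of p. -/
open Polynomial MeasureTheory

/-- Local lower bound for a polynomial at a point that is not a multiple root. -/
lemma local_lower_bound (q : ℝ[X]) (x : ℝ) (h : q.eval x = 0 → q.derivative.eval x ≠ 0) :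
    ∃ c : ℝ, 0 < c ∧ ∀ᶠ y in nhds x, c * |y - x| ≤ |q.eval y| := by
  by_cases hx : q.eval x = 0
  · have hd := h hx
    have h1 := (hasDerivAt_iff_tendsto_slope.1 (q.hasDerivAt x)).abs
    refine ⟨|q.derivative.eval x| / 2, by positivity, ?_⟩
    have h2 : |q.derivative.eval x| / 2 < |q.derivative.eval x| :=
      half_lt_self (abs_pos.2 hd)
    have h3 := h1.eventually (lt_mem_nhds h2)
    rw [eventually_nhdsWithin_iff] at h3
    filter_upwards [h3] with y hy
    by_cases hyx : y = x
    · simp [hyx]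
    · have h4 := hy hyx
      rw [slope_def_field, hx, sub_zero, abs_div,
        lt_div_iff₀ (abs_pos.2 (sub_ne_zero.2 hyx))] at h4
      exact h4.le
  · refine ⟨|q.eval x| / 2, by positivity, ?_⟩
    have h2 : |q.eval x| / 2 < |q.eval x| := half_lt_self (abs_pos.2 hx)
    have h3 := (q.continuous.abs.tendsto x).eventually (lt_mem_nhds h2)
    filter_upwards [h3, Metric.ball_mem_nhds x one_pos] with y hy hy1
    rw [Metric.mem_ball, Real.dist_eq] at hy1
    have : 0 ≤ |q.eval x| / 2 := by positivity
    nlinarith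

lemma volume_bound (q : ℝ[X]) (h : ∀ x, q.eval x = 0 → q.derivative.eval x ≠ 0)
    (K : Set ℝ) (hK : IsCompact K) :
    ∃ C : NNReal, ∀ ε : ℝ, volume (K ∩ {x | |q.eval x| ≤ ε}) ≤ C * ENNReal.ofReal ε := by
  refine hK.induction_on (p := fun s => ∃ C : NNReal, ∀ ε : ℝ,
    volume (s ∩ {x | |q.eval x| ≤ ε}) ≤ C * ENNReal.ofReal ε) ?_ ?_ ?_ ?_
  · exact ⟨0, by simp⟩
  · rintro s t hst ⟨C, hC⟩
    exact ⟨C, fun ε => (measure_mono (Set.inter_subset_inter_left _ hst)).trans (hC ε)⟩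
  · rintro s t ⟨C, hC⟩ ⟨D, hD⟩
    refine ⟨C + D, fun ε => ?_⟩
    rw [Set.union_inter_distrib_right]
    refine (measure_union_le _ _).trans ((add_le_add (hC ε) (hD ε)).trans ?_)
    rw [ENNReal.coe_add, add_mul]
  · intro x _
    obtain ⟨c, hc, hev⟩ := local_lower_bound q x (h x)
    refine ⟨_, mem_nhdsWithin_of_mem_nhds hev, (2 / c).toNNReal, fun ε => ?_⟩
    have hsub : {y | c * |y - x| ≤ |q.eval y|} ∩ {y | |q.eval y| ≤ ε}
        ⊆ Metric.closedBall x (ε / c) := by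
      rintro y ⟨h1, h2⟩
      simp only [Set.mem_ofPred_eq] at h1 h2
      rw [Metric.mem_closedBall, Real.dist_eq, le_div_iff₀ hc]
      linarith
    refine (measure_mono hsub).trans ?_
    rw [Real.volume_closedBall, ← ENNReal.ofReal.eq_1, ← ENNReal.ofReal_mul (by positivity)]
    apply le_of_eq
    congr 1
    ring

lemma compact_sublevel (q : ℝ[X]) (hq : 1 ≤ q.natDegree) :
    IsCompact {x : ℝ | |q.eval x| ≤ 1} := by
  have hdeg : 0 < q.degree := natDegree_pos_iff_degree_pos.1 hq
  have h1 : Filter.Tendsto (fun x : ℝ => ‖q.eval x‖) (Filter.cocompact ℝ) Filter.atTop :=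
    q.tendsto_norm_atTop hdeg (tendsto_norm_cocompact_atTop)
  have h2 := h1.eventually (Filter.eventually_gt_atTop 1)
  obtain ⟨t, ht, hts⟩ := Filter.mem_cocompact.1 h2
  refine ht.of_isClosed_subset (isClosed_le q.continuous.abs continuous_const) ?_
  intro x hx
  by_contra hxt
  have := hts hxt
  simp only [Set.mem_ofPred_eq, Real.norm_eq_abs] at this hx
  linarith

lemma not_critical (p : ℝ[X]) (hp : 1 ≤ p.natDegree)
    (f : ℝ → ℝ) (hf_cont : Continuous f) (hint : Integrable f) (d : ℝ)
    (h : ∀ x, p.eval x = d → p.derivative.eval x ≠ 0) :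
    ¬ IsRiskCriticalPoint (thresholdRisk f p) d := by
  unfold IsRiskCriticalPoint
  rw [not_not]
  have hq : 1 ≤ (p - C d).natDegree := by rwa [natDegree_sub_C]
  have hK := compact_sublevel _ hq
  obtain ⟨A, hA⟩ := volume_bound (p - C d)
    (fun x hx => by simpa using h x (by simpa [sub_eq_zero] using hx)) _ hK
  obtain ⟨B, hB⟩ := hK.exists_bound_of_continuousOn hf_cont.continuousOn
  have hfin : IsFiniteMeasure (volume.withDensity fun x => ENNReal.ofReal (f x)) :=
    isFiniteMeasure_withDensity_ofReal hint.2
  refine ⟨Metric.ball d 1, Metric.ball_mem_nhds d one_pos, B.toNNReal * A, ?_⟩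
  intro δ hδ hne
  rw [Metric.mem_ball, Real.dist_eq] at hδ
  have hpos : 0 < |δ - d| := abs_pos.2 (sub_ne_zero.2 hne)
  rw [div_le_iff₀ hpos]
  set μ := volume.withDensity fun x => ENNReal.ofReal (f x) with hμ
  set S : Set ℝ := {x | |(p - C d).eval x| ≤ 1} ∩ {x | |(p - C d).eval x| ≤ |δ - d|} with hS
  have hSm : MeasurableSet S :=
    ((isClosed_le (p - C d).continuous.abs continuous_const).inter
      (isClosed_le (p - C d).continuous.abs continuous_const)).measurableSet
  have hμS : μ S ≤ ENNReal.ofReal (B.toNNReal * A * |δ - d|) := by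
    rw [hμ, withDensity_apply _ hSm]
    calc ∫⁻ x in S, ENNReal.ofReal (f x) ≤ ∫⁻ x in S, ENNReal.ofReal B := by
          refine setLIntegral_mono measurable_const fun x hx => ?_
          exact ENNReal.ofReal_le_ofReal ((le_abs_self _).trans (hB x hx.1))
      _ = ENNReal.ofReal B * volume S := by simp
      _ ≤ ENNReal.ofReal B * (A * ENNReal.ofReal |δ - d|) := by gcongr; exact hA _
      _ = _ := by
          rw [ENNReal.ofReal_mul (by positivity), ENNReal.ofReal_mul (by positivity)]
          rw [ENNReal.ofReal_coe_nnreal, ENNReal.ofReal_coe_nnreal, mul_assoc]; rfl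
  have hμS' : μ.real S ≤ B.toNNReal * A * |δ - d| :=
    ENNReal.toReal_le_of_le_ofReal (by positivity) hμS
  have key : ∀ a b : ℝ, {x | p.eval x < a} ⊆ {x | p.eval x < b} ∪ S →
      μ.real {x | p.eval x < a} ≤ μ.real {x | p.eval x < b} + μ.real S := fun a b hab =>
    (measureReal_mono hab).trans (measureReal_union_le _ _)
  have hsub : ∀ x, |p.eval x - d| ≤ |δ - d| → x ∈ S := by
    intro x hx
    simp only [hS, Set.mem_inter_iff, Set.mem_ofPred_eq, eval_sub, eval_C]
    exact ⟨hx.trans hδ.le, hx⟩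
  have k1 := key δ d (by
    intro x hx
    by_cases hxd : p.eval x < d
    · exact Or.inl hxd
    · refine Or.inr (hsub x ?_)
      simp only [Set.mem_ofPred_eq] at hx
      rw [abs_of_nonneg (by linarith), abs_of_nonneg (by linarith)]
      linarith)
  have k2 := key d δ (by
    intro x hx
    by_cases hxd : p.eval x < δ
    · exact Or.inl hxd
    · refine Or.inr (hsub x ?_)
      simp only [Set.mem_ofPred_eq] at hx
      rw [abs_of_nonpos (by linarith), abs_of_nonpos (by linarith)]
      linarith)
  change |μ.real {x | p.eval x < δ} - μ.real {x | p.eval x < d}| ≤ _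
  rw [abs_le]
  constructor <;> linarith

/-- The set of risk critical points of the threshold risk function is finite, with at most
`n - 1` elements, where `n` is the degree of `p`. -/
theorem finitely_many_riskCriticalPoints
    (p : Polynomial ℝ) (hp : 1 ≤ p.natDegree)
    (f : ℝ → ℝ) (hf_cont : Continuous f) (hf_nonneg : ∀ x, 0 ≤ f x)
    (hf_int : ∫ x : ℝ, f x = 1) :
    {δ₀ : ℝ | IsRiskCriticalPoint (thresholdRisk f p) δ₀}.Finite ∧
    {δ₀ : ℝ | IsRiskCriticalPoint (thresholdRisk f p) δ₀}.ncard ≤ p.natDegree - 1 := by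
  classical
  have hint : Integrable f := by
    by_contra hn
    rw [integral_undef hn] at hf_int
    exact zero_ne_one hf_int
  have hd : p.derivative ≠ 0 := fun h0 => by
    have := derivative_eq_zero.1 h0
    omega
  have hsub : {δ₀ : ℝ | IsRiskCriticalPoint (thresholdRisk f p) δ₀} ⊆
      ((p.derivative.roots.toFinset.image fun x => p.eval x : Finset ℝ) : Set ℝ) := by
    intro d hcrit
    by_contra hnot
    refine not_critical p hp f hf_cont hint d (fun x hx hx0 => hnot ?_) hcrit
    simp only [Finset.coe_image, Set.mem_image, Finset.mem_coe, Multiset.mem_toFinset]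
    exact ⟨x, (mem_roots hd).2 hx0, hx⟩
  refine ⟨(Finset.finite_toSet _).subset hsub, ?_⟩
  calc _ ≤ _ := Set.ncard_le_ncard hsub (Finset.finite_toSet _)
    _ = _ := Set.ncard_coe_finset _
    _ ≤ _ := Finset.card_image_le
    _ ≤ _ := Multiset.toFinset_card_le _
    _ ≤ _ := card_roots' _
    _ ≤ _ := natDegree_derivative_le p
end

section
/- Let δ₀ ∈ ℝ and suppose every real root of p − δ₀ is simple (for all r ∈ ℝ, p(r) = δ₀ implies p'(r) ≠ 0). Then there exist ε > 0 and a constant C ≥ 0 such that |R(δ) − R(δ₀)| ≤ C·|δ − δ₀| for all δ with |δ − δ₀| < ε; in particular δ₀ is not a risk critical point. -/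
open Polynomial MeasureTheory

/-- Local bound on the measure of the tube `|p - δ₀| ≤ η`. -/
theorem local_tube_bound (p : Polynomial ℝ) (f : ℝ → ℝ) (hf_cont : Continuous f)
    (μ : Measure ℝ) [IsFiniteMeasure μ]
    (hμ : μ = volume.withDensity fun x => ENNReal.ofReal (f x))
    (δ₀ : ℝ) (hsimple : ∀ r : ℝ, p.eval r = δ₀ → (derivative p).eval r ≠ 0) (x : ℝ) :
    ∃ t ∈ nhds x, ∃ ε > (0 : ℝ), ∃ C : ℝ, 0 ≤ C ∧ ∀ η : ℝ, 0 ≤ η → η < ε →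
      μ.real (t ∩ {y | |p.eval y - δ₀| ≤ η}) ≤ C * η := by
  by_cases hx : p.eval x = δ₀
  · have hd := p.hasDerivAt x
    have hne := hsimple x hx
    set d := (derivative p).eval x with hd_def
    have hdpos : 0 < |d| := abs_pos.mpr hne
    have h1 : ∀ᶠ y in nhds x, ‖p.eval y - p.eval x - (y - x) • d‖ ≤ |d| / 2 * ‖y - x‖ :=
      (hasDerivAt_iff_isLittleO.mp hd).def (by positivity)
    have h2 : ∀ᶠ y in nhds x, f y < f x + 1 :=
      hf_cont.continuousAt.eventually_lt continuousAt_const (by linarith)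
    have h3 := h1.and h2
    obtain ⟨t, htn, ht⟩ := h3.exists_mem
    set M := max (f x + 1) 0 with hM
    have hM0 : 0 ≤ M := le_max_right _ _
    refine ⟨t, htn, 1, one_pos, M * (2 * (2 / |d|)), by positivity, fun η hη _ => ?_⟩
    have hsub : t ∩ {y | |p.eval y - δ₀| ≤ η} ⊆ Metric.closedBall x (2 / |d| * η) ∩ {y | f y ≤ M} := by
      rintro y ⟨hyt, hy⟩
      obtain ⟨ha, hb⟩ := ht y hyt
      refine ⟨?_, (le_of_lt hb).trans (le_max_left _ _)⟩
      simp only [Set.mem_ofPred_eq] at hy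
      rw [hx, Real.norm_eq_abs, Real.norm_eq_abs, smul_eq_mul] at ha
      rw [Metric.mem_closedBall, Real.dist_eq]
      have hc : |(y - x) * d| ≤ |p.eval y - δ₀| + |p.eval y - δ₀ - (y - x) * d| := by
        have := abs_sub (p.eval y - δ₀) (p.eval y - δ₀ - (y - x) * d)
        simpa using this
      rw [abs_mul] at hc
      rw [div_mul_eq_mul_div, le_div_iff₀ hdpos]
      nlinarith
    have hmeas : MeasurableSet (Metric.closedBall x (2 / |d| * η) ∩ {y | f y ≤ M}) :=
      Metric.isClosed_closedBall.measurableSet.inter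
        (isClosed_le hf_cont continuous_const).measurableSet
    have hle : μ (Metric.closedBall x (2 / |d| * η) ∩ {y | f y ≤ M})
        ≤ ENNReal.ofReal (M * (2 * (2 / |d|)) * η) := by
      rw [hμ, withDensity_apply _ hmeas]
      calc _ ≤ ∫⁻ y in (Metric.closedBall x (2 / |d| * η) ∩ {y | f y ≤ M}), ENNReal.ofReal M :=
            setLIntegral_mono' hmeas (fun y hy => ENNReal.ofReal_le_ofReal hy.2)
        _ = ENNReal.ofReal M * volume (Metric.closedBall x (2 / |d| * η) ∩ {y | f y ≤ M}) := by
            rw [setLIntegral_const]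
        _ ≤ ENNReal.ofReal M * volume (Metric.closedBall x (2 / |d| * η)) := by
            gcongr; exact Set.inter_subset_left
        _ = _ := by
            rw [Real.volume_closedBall, ← ENNReal.ofReal_mul hM0]
            congr 1; ring
    calc μ.real _ ≤ μ.real (Metric.closedBall x (2 / |d| * η) ∩ {y | f y ≤ M}) :=
          measureReal_mono hsub
      _ ≤ _ := ENNReal.toReal_le_of_le_ofReal (by positivity) hle
  · have hpos : 0 < |p.eval x - δ₀| := abs_pos.mpr (sub_ne_zero.mpr hx)
    have hcont : Continuous fun y => |p.eval y - δ₀| := (p.continuous.sub continuous_const).abs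
    have h1 : ∀ᶠ y in nhds x, |p.eval x - δ₀| / 2 < |p.eval y - δ₀| :=
      continuousAt_const.eventually_lt hcont.continuousAt (by linarith)
    refine ⟨_, h1, |p.eval x - δ₀| / 2, by positivity, 0, le_rfl, fun η _ hη => ?_⟩
    have : {y | |p.eval x - δ₀| / 2 < |p.eval y - δ₀|} ∩ {y | |p.eval y - δ₀| ≤ η} = ∅ := by
      ext y
      simp only [Set.mem_inter_iff, Set.mem_ofPred_eq, Set.mem_empty_iff_false, iff_false, not_and]
      intro h h'
      linarith
    rw [this]
    simp

/-- If every real root of `p - δ₀` is simple, then the threshold risk is locally Lipschitz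
at `δ₀`; in particular `δ₀` is not a risk critical point. -/
theorem not_riskCriticalPoint_of_simple_roots
    (p : Polynomial ℝ) (hp : 1 ≤ p.natDegree)
    (f : ℝ → ℝ) (hf_cont : Continuous f) (hf_nonneg : ∀ x, 0 ≤ f x)
    (hf_int : ∫ x : ℝ, f x = 1)
    (δ₀ : ℝ) (hsimple : ∀ r : ℝ, p.eval r = δ₀ → (derivative p).eval r ≠ 0) :
    (∃ ε > (0 : ℝ), ∃ C : ℝ, 0 ≤ C ∧ ∀ δ : ℝ, |δ - δ₀| < ε →
        |thresholdRisk f p δ - thresholdRisk f p δ₀| ≤ C * |δ - δ₀|) ∧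
    ¬ IsRiskCriticalPoint (thresholdRisk f p) δ₀ := by
  have main : ∃ ε > (0 : ℝ), ∃ C : ℝ, 0 ≤ C ∧ ∀ δ : ℝ, |δ - δ₀| < ε →
        |thresholdRisk f p δ - thresholdRisk f p δ₀| ≤ C * |δ - δ₀| := by
    have hint : Integrable f := by
      by_contra h
      rw [integral_undef h] at hf_int
      exact zero_ne_one hf_int
    obtain ⟨μ, hμ⟩ : ∃ μ : Measure ℝ, μ = volume.withDensity fun x => ENNReal.ofReal (f x) :=
      ⟨_, rfl⟩
    have : IsFiniteMeasure μ := by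
      rw [hμ]; exact isFiniteMeasure_withDensity_ofReal hint.2
    -- far away `p` is far from `δ₀`
    have htend : Filter.Tendsto (fun x : ℝ => ‖p.eval x‖) (Filter.cocompact ℝ) Filter.atTop :=
      p.tendsto_norm_atTop (natDegree_pos_iff_degree_pos.mp hp) tendsto_norm_cocompact_atTop
    obtain ⟨K, hK, hKs⟩ := Filter.mem_cocompact.mp (htend.eventually_gt_atTop (|δ₀| + 1))
    have hcomp : ∃ ε > (0 : ℝ), ∃ C : ℝ, 0 ≤ C ∧ ∀ η : ℝ, 0 ≤ η → η < ε →
        μ.real (K ∩ {y | |p.eval y - δ₀| ≤ η}) ≤ C * η := by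
      refine hK.induction_on (p := fun s => ∃ ε > (0 : ℝ), ∃ C : ℝ, 0 ≤ C ∧ ∀ η : ℝ, 0 ≤ η → η < ε →
        μ.real (s ∩ {y | |p.eval y - δ₀| ≤ η}) ≤ C * η) ?_ ?_ ?_ ?_
      · exact ⟨1, one_pos, 0, le_rfl, fun η _ _ => by simp⟩
      · rintro s t hst ⟨ε, hε, C, hC, h⟩
        exact ⟨ε, hε, C, hC, fun η h0 h1 =>
          (measureReal_mono (Set.inter_subset_inter_left _ hst)).trans (h η h0 h1)⟩
      · rintro s t ⟨ε, hε, C, hC, h⟩ ⟨ε', hε', C', hC', h'⟩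
        refine ⟨min ε ε', lt_min hε hε', C + C', by positivity, fun η h0 h1 => ?_⟩
        rw [Set.union_inter_distrib_right, add_mul]
        exact (measureReal_union_le _ _).trans (add_le_add
          (h η h0 (h1.trans_le (min_le_left _ _))) (h' η h0 (h1.trans_le (min_le_right _ _))))
      · intro x _
        obtain ⟨t, ht, h⟩ := local_tube_bound p f hf_cont μ hμ δ₀ hsimple x
        exact ⟨t, mem_nhdsWithin_of_mem_nhds ht, h⟩
    obtain ⟨ε, hε, C, hC, h⟩ := hcomp
    refine ⟨min ε 1, lt_min hε one_pos, C, hC, fun δ hδ => ?_⟩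
    have hb := h _ (abs_nonneg (δ - δ₀)) (hδ.trans_le (min_le_left _ _))
    have hδ1 := hδ.trans_le (min_le_right _ _)
    have hT : ∀ y, |p.eval y - δ₀| ≤ |δ - δ₀| → y ∈ K := by
      intro y hy
      by_contra hyK
      have h1 : |δ₀| + 1 < ‖p.eval y‖ := hKs hyK
      rw [Real.norm_eq_abs] at h1
      have := abs_sub_abs_le_abs_sub (p.eval y) δ₀
      linarith
    have key : ∀ a b : ℝ, ({x | p.eval x < a} \ {x | p.eval x < b} ⊆
        K ∩ {y | |p.eval y - δ₀| ≤ |δ - δ₀|}) →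
        μ.real {x | p.eval x < a} ≤ μ.real {x | p.eval x < b} + C * |δ - δ₀| := by
      intro a b hs
      calc μ.real {x | p.eval x < a}
          ≤ μ.real ({x | p.eval x < b} ∪ (K ∩ {y | |p.eval y - δ₀| ≤ |δ - δ₀|})) := by
            refine measureReal_mono ?_
            intro y hy
            by_cases hyb : y ∈ {x | p.eval x < b}
            · exact Or.inl hyb
            · exact Or.inr (hs ⟨hy, hyb⟩)
        _ ≤ _ := (measureReal_union_le _ _).trans (by gcongr)
    have k1 := key δ δ₀ (by
      rintro y ⟨h1, h2⟩
      simp only [Set.mem_ofPred_eq, not_lt] at h1 h2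
      have : |p.eval y - δ₀| ≤ |δ - δ₀| := abs_le_abs_of_nonneg (by linarith) (by linarith)
      exact ⟨hT y this, this⟩)
    have k2 := key δ₀ δ (by
      rintro y ⟨h1, h2⟩
      simp only [Set.mem_ofPred_eq, not_lt] at h1 h2
      have : |p.eval y - δ₀| ≤ |δ - δ₀| := abs_le_abs_of_nonpos (by linarith) (by linarith)
      exact ⟨hT y this, this⟩)
    have e : ∀ a, thresholdRisk f p a = μ.real {x | p.eval x < a} := by
      intro a; rw [hμ]; rfl
    rw [e, e, abs_le]
    constructor <;> linarith
  refine ⟨main, ?_⟩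
  obtain ⟨ε, hε, C, hC, h⟩ := main
  intro hcrit
  refine hcrit ⟨Metric.ball δ₀ ε, Metric.ball_mem_nhds _ hε, C, fun δ hδ hne => ?_⟩
  rw [Metric.mem_ball, Real.dist_eq] at hδ
  rw [div_le_iff₀ (abs_pos.mpr (sub_ne_zero.mpr hne))]
  exact h δ hδ
end

section
/- Let p ∈ ℝ[X] be nonconstant, let δ₀ ∈ ℝ, and let r₀ ∈ ℝ be a root of p − δ₀ of odd multiplicity m (i.e. (X − r₀)^m divides p − δ₀, (X − r₀)^{m+1} does not, and m is odd). Then there exist ε > 0 and an open neighbourhood U of r₀ such that for every δ ∈ ℝ with |δ − δ₀| < ε there is exactly one x ∈ U with p(x) = δ. -/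
open Polynomial

theorem single_branch_aux (p q : Polynomial ℝ) (δ₀ r₀ : ℝ) (k : ℕ)
    (hpq : p - C δ₀ = (X - C r₀) ^ (2 * k + 1) * q) (hq : 0 < q.eval r₀) :
    ∃ ε > (0 : ℝ), ∃ U : Set ℝ, IsOpen U ∧ r₀ ∈ U ∧
      ∀ δ : ℝ, |δ - δ₀| < ε → ∃! x : ℝ, x ∈ U ∧ p.eval x = δ := by
  have hpe : p = C δ₀ + (X - C r₀) ^ (2 * k + 1) * q := by rw [← hpq]; ring
  set s : Polynomial ℝ := C (2 * (k : ℝ) + 1) * q + (X - C r₀) * derivative q with hs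
  have hder : ∀ x, deriv (fun y => p.eval y) x = ((x - r₀) ^ k) ^ 2 * s.eval x := by
    intro x
    rw [Polynomial.deriv, hpe, hs]
    simp [derivative_pow]
    ring
  have hs0 : 0 < s.eval r₀ := by
    simp only [hs, eval_add, eval_mul, eval_C, eval_sub, eval_X, sub_self, zero_mul, add_zero]
    positivity
  have hev : ∀ᶠ x in nhds r₀, 0 < s.eval x :=
    s.continuous.continuousAt.eventually (lt_mem_nhds hs0)
  obtain ⟨d, hd, hball⟩ := Metric.eventually_nhds_iff.1 hev
  set e := d / 2 with he
  have he0 : 0 < e := by positivity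
  have hpos : ∀ x, r₀ - e ≤ x → x ≤ r₀ + e → x ≠ r₀ → 0 < deriv (fun y => p.eval y) x := by
    intro x h1 h2 h3
    rw [hder]
    have : 0 < s.eval x := by
      apply hball
      rw [Real.dist_eq, abs_lt]
      constructor <;> linarith
    have h4 : x - r₀ ≠ 0 := sub_ne_zero.2 h3
    positivity
  have hm1 : StrictMonoOn (fun y => p.eval y) (Set.Icc (r₀ - e) r₀) := by
    apply strictMonoOn_of_deriv_pos (convex_Icc _ _) p.continuous.continuousOn
    intro x hx
    rw [interior_Icc] at hx
    exact hpos x hx.1.le (by linarith [hx.2]) hx.2.ne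
  have hm2 : StrictMonoOn (fun y => p.eval y) (Set.Icc r₀ (r₀ + e)) := by
    apply strictMonoOn_of_deriv_pos (convex_Icc _ _) p.continuous.continuousOn
    intro x hx
    rw [interior_Icc] at hx
    exact hpos x (by linarith [hx.1]) hx.2.le hx.1.ne'
  have hm : StrictMonoOn (fun y => p.eval y) (Set.Icc (r₀ - e) (r₀ + e)) := by
    have := hm1.union hm2 (isGreatest_Icc (by linarith)) (isLeast_Icc (by linarith))
    rwa [Set.Icc_union_Icc_eq_Icc (by linarith) (by linarith)] at this
  have hr : p.eval r₀ = δ₀ := by rw [hpe]; simp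
  have hlo : p.eval (r₀ - e) < δ₀ := by
    rw [← hr]
    exact hm ⟨by linarith, by linarith⟩ ⟨by linarith, by linarith⟩ (by linarith)
  have hhi : δ₀ < p.eval (r₀ + e) := by
    rw [← hr]
    exact hm ⟨by linarith, by linarith⟩ ⟨by linarith, by linarith⟩ (by linarith)
  refine ⟨min (p.eval (r₀ + e) - δ₀) (δ₀ - p.eval (r₀ - e)),
    lt_min (by linarith) (by linarith), Set.Ioo (r₀ - e) (r₀ + e), isOpen_Ioo,
    ⟨by linarith, by linarith⟩, ?_⟩
  intro δ hδ
  obtain ⟨h1, h2⟩ := lt_min_iff.1 hδ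
  have h1' := (abs_lt.1 h1).2
  have h2' := (abs_lt.1 h2).1
  obtain ⟨x, hx, hxe⟩ := intermediate_value_Ioo (show r₀ - e ≤ r₀ + e by linarith)
    (p.continuous.continuousOn) (show δ ∈ Set.Ioo _ _ from ⟨by linarith, by linarith⟩)
  refine ⟨x, ⟨hx, hxe⟩, ?_⟩
  rintro y ⟨hy, hye⟩
  exact hm.injOn (Set.Ioo_subset_Icc_self hy) (Set.Ioo_subset_Icc_self hx) (hye.trans hxe.symm)

/-- A root `r₀` of odd multiplicity `m` of `p - δ₀` continues as a single real branch:
there are `ε > 0` and an open neighbourhood `U` of `r₀` such that for every `δ` with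
`|δ - δ₀| < ε` the equation `p(x) = δ` has exactly one solution `x ∈ U`. -/
theorem odd_multiplicity_root_single_branch
    (p : Polynomial ℝ) (hp : 0 < p.natDegree) (δ₀ r₀ : ℝ) (m : ℕ) (hodd : Odd m)
    (hdvd : (X - C r₀) ^ m ∣ (p - C δ₀))
    (hndvd : ¬ (X - C r₀) ^ (m + 1) ∣ (p - C δ₀)) :
    ∃ ε > (0 : ℝ), ∃ U : Set ℝ, IsOpen U ∧ r₀ ∈ U ∧
      ∀ δ : ℝ, |δ - δ₀| < ε → ∃! x : ℝ, x ∈ U ∧ p.eval x = δ := by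
  obtain ⟨q, hq⟩ := hdvd
  obtain ⟨k, rfl⟩ := hodd
  have hq0 : q.eval r₀ ≠ 0 := by
    intro h
    obtain ⟨t, ht⟩ := dvd_iff_isRoot.2 h
    exact hndvd ⟨t, by rw [hq, ht]; ring⟩
  rcases lt_or_gt_of_ne hq0 with h | h
  · obtain ⟨ε, hε, U, hU, hr, H⟩ := single_branch_aux (-p) (-q) (-δ₀) r₀ k
      (by rw [mul_neg, ← hq, C_neg]; ring) (by simpa using h)
    refine ⟨ε, hε, U, hU, hr, fun δ hδ => ?_⟩
    have := H (-δ) (by rwa [← abs_neg, show -(-δ - -δ₀) = δ - δ₀ by ring])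
    simpa using this
  · exact single_branch_aux p q δ₀ r₀ k hq h
end

section
/- Let δ₀ ∈ ℝ and suppose: r₀ ∈ ℝ is a root of p − δ₀ of even multiplicity; p(x) > δ₀ for all x in some deleted neighbourhood of r₀; every real root of p − δ₀ other than r₀ is simple; and f(r₀) > 0. Then (R(δ) − R(δ₀))/(δ − δ₀) → ∞ as δ → δ₀ from above; in particular δ₀ is a risk critical point. -/
open Polynomial MeasureTheory Filter

/-- If `r₀` is a root of `p - δ₀` of even multiplicity at which `p` has a strict local minimum
with value `δ₀`, every other real root of `p - δ₀` is simple, and `f(r₀) > 0`, then the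
difference quotients of the threshold risk diverge to `∞` as `δ → δ₀⁺`; in particular `δ₀`
is a risk critical point. -/
theorem riskCriticalPoint_of_even_multiplicity_local_min
    (p : Polynomial ℝ) (hp : 1 ≤ p.natDegree)
    (f : ℝ → ℝ) (hf_cont : Continuous f) (hf_nonneg : ∀ x, 0 ≤ f x)
    (hf_int : ∫ x : ℝ, f x = 1)
    (δ₀ r₀ : ℝ) (m : ℕ) (heven : Even m)
    (hroot : p.eval r₀ = δ₀)
    (hdvd : (X - C r₀) ^ m ∣ (p - C δ₀))
    (hndvd : ¬ (X - C r₀) ^ (m + 1) ∣ (p - C δ₀))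
    (hmin : ∃ η > (0 : ℝ), ∀ x : ℝ, x ≠ r₀ → |x - r₀| < η → δ₀ < p.eval x)
    (hsimple : ∀ r : ℝ, p.eval r = δ₀ → r ≠ r₀ → (derivative p).eval r ≠ 0)
    (hpos : 0 < f r₀) :
    Tendsto (fun δ => (thresholdRisk f p δ - thresholdRisk f p δ₀) / (δ - δ₀))
        (nhdsWithin δ₀ (Set.Ioi δ₀)) atTop ∧
    IsRiskCriticalPoint (thresholdRisk f p) δ₀ := by
  have hint : Integrable f := by
    by_contra h
    rw [integral_undef h] at hf_int
    exact zero_ne_one hf_int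
  obtain ⟨η, hη, hmin⟩ := hmin
  have hge : ∀ x : ℝ, |x - r₀| < η → δ₀ ≤ p.eval x := by
    intro x hx
    by_cases h : x = r₀
    · rw [h, hroot]
    · exact (hmin x h hx).le
  have hball : ∀ᶠ x in nhds r₀, |x - r₀| < η := by
    filter_upwards [Metric.ball_mem_nhds r₀ hη] with x hx
    simpa [Real.dist_eq] using hx
  have hder0 : (derivative p).eval r₀ = 0 := by
    have hl : IsLocalMin (fun x => p.eval x) r₀ := by
      filter_upwards [hball] with x hx
      simpa [hroot] using hge x hx
    exact hl.hasDerivAt_eq_zero (p.hasDerivAt r₀)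
  have hlo : (fun x => p.eval x - p.eval r₀) =o[nhds r₀] fun x => x - r₀ := by
    have h := (p.hasDerivAt r₀).isLittleO
    simpa [hder0] using h
  set μ := (volume.withDensity fun x => ENNReal.ofReal (f x)) with hμ
  have hfin : IsFiniteMeasure μ := isFiniteMeasure_withDensity_ofReal hint.2
  -- key lower bound
  have key : ∀ K : ℝ, 0 < K → ∀ᶠ δ in nhdsWithin δ₀ (Set.Ioi δ₀),
      f r₀ * K * (δ - δ₀) ≤ thresholdRisk f p δ - thresholdRisk f p δ₀ := by
    intro K hK
    have h1 := hlo.def (inv_pos.mpr hK)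
    have h2 : ∀ᶠ x in nhds r₀, f r₀ / 2 < f x :=
      hf_cont.continuousAt.eventually (lt_mem_nhds (by linarith))
    obtain ⟨ε, hε, hb⟩ := Metric.eventually_nhds_iff_ball.mp (h1.and (h2.and hball))
    have hh : ∀ᶠ δ in nhdsWithin δ₀ (Set.Ioi δ₀), δ < δ₀ + ε / K :=
      mem_nhdsWithin_of_mem_nhds (gt_mem_nhds (by have := div_pos hε hK; linarith))
    filter_upwards [hh, self_mem_nhdsWithin] with δ hδ hδ'
    have hpos' : 0 < δ - δ₀ := sub_pos.mpr hδ'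
    have hKd : K * (δ - δ₀) < ε := by
      have : δ - δ₀ < ε / K := by linarith
      rw [lt_div_iff₀ hK] at this
      linarith
    set J := Metric.ball r₀ (K * (δ - δ₀)) with hJ
    have hJb : ∀ x ∈ J, x ∈ Metric.ball r₀ ε := fun x hx => Metric.ball_subset_ball hKd.le hx
    have hdisj : Disjoint {x : ℝ | p.eval x < δ₀} J := by
      rw [Set.disjoint_left]
      intro x hx hxJ
      exact absurd (hge x (hb x (hJb x hxJ)).2.2) (not_le.mpr hx)
    have hsub : {x : ℝ | p.eval x < δ₀} ∪ J ⊆ {x : ℝ | p.eval x < δ} := by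
      rintro x (hx | hx)
      · have hx' : p.eval x < δ₀ := hx
        have h3 : δ₀ < δ := hδ'
        exact hx'.trans h3
      · have h3 := (hb x (hJb x hx)).1
        rw [hroot, Real.norm_eq_abs, Real.norm_eq_abs] at h3
        have h4 : |x - r₀| < K * (δ - δ₀) := by simpa [hJ, Real.dist_eq] using hx
        have h5 : K⁻¹ * |x - r₀| < δ - δ₀ := by
          rw [inv_mul_lt_iff₀ hK]; exact h4
        have h6 := le_abs_self (p.eval x - δ₀)
        show p.eval x < δ
        linarith
    have hm : μ.real {x : ℝ | p.eval x < δ₀} + μ.real J ≤ μ.real {x : ℝ | p.eval x < δ} := by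
      rw [← measureReal_union hdisj Metric.isOpen_ball.measurableSet]
      exact measureReal_mono hsub
    have hJm : f r₀ * K * (δ - δ₀) ≤ μ.real J := by
      have hle : ENNReal.ofReal (f r₀ / 2) * volume J ≤ μ J := by
        rw [hμ, withDensity_apply _ Metric.isOpen_ball.measurableSet, ← setLIntegral_const]
        exact setLIntegral_mono' Metric.isOpen_ball.measurableSet
          fun x hx => ENNReal.ofReal_le_ofReal (hb x (hJb x hx)).2.1.le
      rw [hJ, Real.volume_ball, ← ENNReal.ofReal_mul (by linarith)] at hle
      have := (ENNReal.ofReal_le_iff_le_toReal (measure_ne_top μ _)).mp hle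
      calc f r₀ * K * (δ - δ₀) = f r₀ / 2 * (2 * (K * (δ - δ₀))) := by ring
        _ ≤ _ := this
    have e : ∀ d, thresholdRisk f p d = μ.real {x : ℝ | p.eval x < d} := fun d => rfl
    rw [e, e]
    linarith
  have main : Tendsto (fun δ => (thresholdRisk f p δ - thresholdRisk f p δ₀) / (δ - δ₀))
        (nhdsWithin δ₀ (Set.Ioi δ₀)) atTop := by
    rw [tendsto_atTop]
    intro b
    have hK : 0 < (|b| + 1) / f r₀ := by positivity
    filter_upwards [key _ hK, self_mem_nhdsWithin] with δ h1 h2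
    have h3 : 0 < δ - δ₀ := sub_pos.mpr h2
    rw [le_div_iff₀ h3]
    rw [mul_div_cancel₀ _ hpos.ne'] at h1
    have := le_abs_self b
    nlinarith
  refine ⟨main, ?_⟩
  rintro ⟨N, hN, B, hB⟩
  obtain ⟨δ, ⟨h1, h2⟩, h3⟩ := (((main.eventually_gt_atTop B).and
    (mem_nhdsWithin_of_mem_nhds hN)).and self_mem_nhdsWithin).exists
  have h4 := hB δ h2 (ne_of_gt h3)
  rw [← abs_div] at h4
  exact absurd (lt_of_lt_of_le h1 (le_abs_self _)) (not_lt.mpr h4)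
end

section
/- Let δ₀ ∈ ℝ and suppose: r₀ ∈ ℝ is a root of p − δ₀ of even multiplicity; p(x) < δ₀ for all x in some deleted neighbourhood of r₀ (r₀ is a strict local maximum of p with value δ₀); and every real root of p − δ₀ other than r₀ is simple. Then the threshold risk is not sensitive to upward perturbations of the threshold at δ₀: there exist ε > 0 and C ≥ 0 such that |R(δ) − R(δ₀)| ≤ C·(δ − δ₀) for all δ ∈ (δ₀, δ₀ + ε). -/
open Polynomial MeasureTheory

open Filter Topology

/-- Each point has a neighbourhood on which the mass of `{δ₀ ≤ p < δ}` is `O(δ - δ₀)`. -/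
lemma local_mass_bound
    (p : Polynomial ℝ) (f : ℝ → ℝ) (hf_cont : Continuous f)
    (δ₀ r₀ : ℝ)
    (hmax : ∃ η > (0 : ℝ), ∀ x : ℝ, x ≠ r₀ → |x - r₀| < η → p.eval x < δ₀)
    (hsimple : ∀ r : ℝ, p.eval r = δ₀ → r ≠ r₀ → (derivative p).eval r ≠ 0) (r : ℝ) :
    ∃ U ∈ 𝓝 r, ∃ ε > (0 : ℝ), ∃ C : ℝ, 0 ≤ C ∧ ∀ δ ∈ Set.Ioo δ₀ (δ₀ + ε),
      (volume.withDensity fun x => ENNReal.ofReal (f x))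
        ({x : ℝ | δ₀ ≤ p.eval x ∧ p.eval x < δ} ∩ U) ≤ ENNReal.ofReal (C * (δ - δ₀)) := by
  have hpc : Continuous fun x => p.eval x := p.continuous
  rcases lt_trichotomy (p.eval r) δ₀ with h | h | h
  · refine ⟨{x | p.eval x < δ₀}, (isOpen_lt hpc continuous_const).mem_nhds h, 1, one_pos, 0, le_rfl, ?_⟩
    intro δ _
    have : {x : ℝ | δ₀ ≤ p.eval x ∧ p.eval x < δ} ∩ {x | p.eval x < δ₀} = ∅ := by
      ext x
      simp only [Set.mem_inter_iff, Set.mem_ofPred_eq, Set.mem_empty_iff_false, iff_false]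
      rintro ⟨⟨h1, _⟩, h2⟩
      linarith
    rw [this]
    simp
  · by_cases hr : r = r₀
    · subst hr
      obtain ⟨η, hη, hm⟩ := hmax
      refine ⟨Metric.ball r η, Metric.ball_mem_nhds _ hη, 1, one_pos, 0, le_rfl, ?_⟩
      intro δ _
      have hsub : {x : ℝ | δ₀ ≤ p.eval x ∧ p.eval x < δ} ∩ Metric.ball r η ⊆ {r} := by
        rintro x ⟨⟨h1, _⟩, h2⟩
        by_contra hx
        have := hm x hx (by simpa [Real.dist_eq] using h2)
        linarith
      have h0 : (volume.withDensity fun x => ENNReal.ofReal (f x)) {r} = 0 :=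
        withDensity_absolutelyContinuous _ _ (by simp)
      exact (measure_mono hsub).trans (by rw [h0]; simp)
    · have hd := hsimple r h hr
      have hD : HasDerivAt (fun x => p.eval x) ((derivative p).eval r) r := p.hasDerivAt r
      obtain ⟨c, hc, hO⟩ := (hD.isTheta_sub hd).2.exists_pos
      have hO' : ∀ᶠ x in 𝓝 r, ‖x - r‖ ≤ c * ‖p.eval x - p.eval r‖ := by
        have h0 := hO.bound
        rw [Filter.prod_pure, eventually_map] at h0
        exact h0
      have hB : ∀ᶠ x in 𝓝 r, f x < |f r| + 1 :=
        hf_cont.continuousAt.eventually_lt continuousAt_const (by linarith [le_abs_self (f r)])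
      refine ⟨_, hO'.and hB, 1, one_pos, (|f r| + 1) * (2 * c), by positivity, ?_⟩
      intro δ hδ
      have hsub : {x : ℝ | δ₀ ≤ p.eval x ∧ p.eval x < δ} ∩
          {x | ‖x - r‖ ≤ c * ‖p.eval x - p.eval r‖ ∧ f x < |f r| + 1} ⊆
          Set.Icc (r - c * (δ - δ₀)) (r + c * (δ - δ₀)) ∩ {x | f x < |f r| + 1} := by
        rintro x ⟨⟨h1, h2⟩, h3, h4⟩
        refine ⟨?_, h4⟩
        rw [h, Real.norm_eq_abs, Real.norm_eq_abs, abs_of_nonneg (by linarith : 0 ≤ p.eval x - δ₀)] at h3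
        have h5 : c * (p.eval x - δ₀) ≤ c * (δ - δ₀) :=
          mul_le_mul_of_nonneg_left (by linarith) hc.le
        have := abs_le.1 (h3.trans h5)
        constructor <;> linarith [this.1, this.2]
      have hmeas : MeasurableSet (Set.Icc (r - c * (δ - δ₀)) (r + c * (δ - δ₀)) ∩
          {x | f x < |f r| + 1}) :=
        measurableSet_Icc.inter (isOpen_lt hf_cont continuous_const).measurableSet
      refine (measure_mono hsub).trans ?_
      rw [withDensity_apply _ hmeas]
      calc _ ≤ ∫⁻ x in (Set.Icc (r - c * (δ - δ₀)) (r + c * (δ - δ₀)) ∩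
            {x | f x < |f r| + 1}), ENNReal.ofReal (|f r| + 1) :=
            setLIntegral_mono' hmeas fun x hx => ENNReal.ofReal_le_ofReal hx.2.le
        _ = ENNReal.ofReal (|f r| + 1) * volume (Set.Icc (r - c * (δ - δ₀)) (r + c * (δ - δ₀)) ∩
            {x | f x < |f r| + 1}) := setLIntegral_const _ _
        _ ≤ ENNReal.ofReal (|f r| + 1) * volume (Set.Icc (r - c * (δ - δ₀)) (r + c * (δ - δ₀))) := by
            gcongr
            exact Set.inter_subset_left
        _ = _ := by
            rw [Real.volume_Icc, ← ENNReal.ofReal_mul (by positivity)]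
            congr 1
            ring
  · refine ⟨{x | (p.eval r + δ₀) / 2 < p.eval x},
      (isOpen_lt continuous_const hpc).mem_nhds (by simp only [Set.mem_ofPred_eq]; linarith),
      (p.eval r - δ₀) / 2, by linarith, 0, le_rfl, ?_⟩
    intro δ hδ
    have : {x : ℝ | δ₀ ≤ p.eval x ∧ p.eval x < δ} ∩ {x | (p.eval r + δ₀) / 2 < p.eval x} = ∅ := by
      ext x
      simp only [Set.mem_inter_iff, Set.mem_ofPred_eq, Set.mem_empty_iff_false, iff_false]
      rintro ⟨⟨_, h1⟩, h2⟩
      linarith [hδ.2]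
    rw [this]
    simp

/-- If `r₀` is a root of `p - δ₀` of even multiplicity at which `p` has a strict local maximum
with value `δ₀`, and every other real root of `p - δ₀` is simple, then the threshold risk is
not sensitive to upward perturbations of the threshold at `δ₀`: there are `ε > 0` and `C ≥ 0`
with `|R(δ) - R(δ₀)| ≤ C (δ - δ₀)` for all `δ ∈ (δ₀, δ₀ + ε)`. -/
theorem no_upward_sensitivity_of_even_multiplicity_local_max
    (p : Polynomial ℝ) (hp : 1 ≤ p.natDegree)
    (f : ℝ → ℝ) (hf_cont : Continuous f) (hf_nonneg : ∀ x, 0 ≤ f x)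
    (hf_int : ∫ x : ℝ, f x = 1)
    (δ₀ r₀ : ℝ) (m : ℕ) (heven : Even m)
    (hroot : p.eval r₀ = δ₀)
    (hdvd : (X - C r₀) ^ m ∣ (p - C δ₀))
    (hndvd : ¬ (X - C r₀) ^ (m + 1) ∣ (p - C δ₀))
    (hmax : ∃ η > (0 : ℝ), ∀ x : ℝ, x ≠ r₀ → |x - r₀| < η → p.eval x < δ₀)
    (hsimple : ∀ r : ℝ, p.eval r = δ₀ → r ≠ r₀ → (derivative p).eval r ≠ 0) :
    ∃ ε > (0 : ℝ), ∃ C : ℝ, 0 ≤ C ∧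
      ∀ δ : ℝ, δ ∈ Set.Ioo δ₀ (δ₀ + ε) →
        |thresholdRisk f p δ - thresholdRisk f p δ₀| ≤ C * (δ - δ₀) := by
  set μ : Measure ℝ := volume.withDensity fun x => ENNReal.ofReal (f x) with hμ
  have hint : Integrable f := by
    by_contra h
    rw [integral_undef h] at hf_int
    exact zero_ne_one hf_int
  have : IsFiniteMeasure μ := isFiniteMeasure_withDensity_ofReal hint.2
  have hcoc : ∀ᶠ x in cocompact ℝ, |δ₀| + 1 < ‖p.eval x‖ :=
    (p.tendsto_norm_atTop (natDegree_pos_iff_degree_pos.1 hp)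
      (tendsto_norm_cocompact_atTop (E := ℝ))).eventually_gt_atTop _
  obtain ⟨K, hK, hKsub⟩ := mem_cocompact.1 hcoc
  have key : ∃ ε > (0 : ℝ), ∃ C : ℝ, 0 ≤ C ∧ ∀ δ ∈ Set.Ioo δ₀ (δ₀ + ε),
      μ ({x : ℝ | δ₀ ≤ p.eval x ∧ p.eval x < δ} ∩ K) ≤ ENNReal.ofReal (C * (δ - δ₀)) := by
    refine hK.induction_on (p := fun s => ∃ ε > (0 : ℝ), ∃ C : ℝ, 0 ≤ C ∧
      ∀ δ ∈ Set.Ioo δ₀ (δ₀ + ε),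
      μ ({x : ℝ | δ₀ ≤ p.eval x ∧ p.eval x < δ} ∩ s) ≤ ENNReal.ofReal (C * (δ - δ₀))) ?_ ?_ ?_ ?_
    · exact ⟨1, one_pos, 0, le_rfl, fun δ _ => by simp⟩
    · rintro s t hst ⟨ε, hε, C, hC, h⟩
      exact ⟨ε, hε, C, hC, fun δ hδ =>
        (measure_mono (Set.inter_subset_inter_right _ hst)).trans (h δ hδ)⟩
    · rintro s t ⟨ε, hε, C, hC, h⟩ ⟨ε', hε', C', hC', h'⟩
      refine ⟨min ε ε', lt_min hε hε', C + C', add_nonneg hC hC', fun δ hδ => ?_⟩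
      have h1 := h δ ⟨hδ.1, by linarith [hδ.2, min_le_left ε ε']⟩
      have h2 := h' δ ⟨hδ.1, by linarith [hδ.2, min_le_right ε ε']⟩
      have h3 : 0 ≤ δ - δ₀ := by linarith [hδ.1]
      rw [Set.inter_union_distrib_left, add_mul,
        ENNReal.ofReal_add (mul_nonneg hC h3) (mul_nonneg hC' h3)]
      exact (measure_union_le _ _).trans (add_le_add h1 h2)
    · intro r _
      obtain ⟨U, hU, h⟩ := local_mass_bound p f hf_cont δ₀ r₀ hmax hsimple r
      exact ⟨U, mem_nhdsWithin_of_mem_nhds hU, h⟩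
  obtain ⟨ε, hε, C, hC, h⟩ := key
  refine ⟨min ε 1, lt_min hε one_pos, C, hC, fun δ hδ => ?_⟩
  have h1 := h δ ⟨hδ.1, by linarith [hδ.2, min_le_left ε 1]⟩
  have h2 : δ < δ₀ + 1 := by linarith [hδ.2, min_le_right ε 1]
  have h0 : 0 ≤ δ - δ₀ := by linarith [hδ.1]
  have hsubK : {x : ℝ | δ₀ ≤ p.eval x ∧ p.eval x < δ} ⊆ K := by
    rintro x ⟨ha, hb⟩
    by_contra hx
    have hc : |δ₀| + 1 < ‖p.eval x‖ := hKsub hx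
    rw [Real.norm_eq_abs] at hc
    have : |p.eval x| ≤ |δ₀| + 1 := by
      rw [abs_le]
      constructor <;> linarith [neg_abs_le δ₀, le_abs_self δ₀]
    linarith
  rw [Set.inter_eq_left.2 hsubK] at h1
  have hsub : {x : ℝ | p.eval x < δ₀} ⊆ {x : ℝ | p.eval x < δ} := fun x hx => lt_trans hx hδ.1
  have hm0 : μ {x : ℝ | p.eval x < δ₀} ≤ μ {x : ℝ | p.eval x < δ} := measure_mono hsub
  have hle : μ {x : ℝ | p.eval x < δ} ≤
      μ {x : ℝ | p.eval x < δ₀} + μ {x : ℝ | δ₀ ≤ p.eval x ∧ p.eval x < δ} := by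
    refine (measure_mono ?_).trans (measure_union_le _ _)
    intro x hx
    rcases lt_or_ge (p.eval x) δ₀ with h | h
    · exact Or.inl h
    · exact Or.inr ⟨h, hx⟩
  have hle' := ENNReal.toReal_mono (by finiteness) hle
  rw [ENNReal.toReal_add (by finiteness) (by finiteness)] at hle'
  have h3 := ENNReal.toReal_le_of_le_ofReal (mul_nonneg hC h0) h1
  have h4 := ENNReal.toReal_mono (by finiteness) hm0
  unfold thresholdRisk
  rw [← hμ, abs_of_nonneg (by linarith)]
  linarith
end

section
/- Let δ₀ ∈ ℝ and suppose r_1 < r_2 < ⋯ < r_l (l ≥ 2) are distinct real roots of p − δ₀, each of even multiplicity and each such that p(x) > δ₀ for all x in some deleted neighbourhood of r_i (each r_i is a strict local minimum of p with value δ₀), while every other real root of p − δ₀ is simple. If f(r_i) > 0 for at least one i ∈ {1, …, l}, then δ₀ is a risk critical point. -/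
open Polynomial MeasureTheory

/-- If `r 0 < r 1 < ⋯ < r (l-1)` (with `l ≥ 2`) are distinct real roots of `p - δ₀`, each of
even multiplicity and each a strict local minimum of `p` with value `δ₀`, every other real root
of `p - δ₀` is simple, and the density `f` is positive at one of these roots, then `δ₀` is a
risk critical point. -/
theorem riskCriticalPoint_of_several_even_multiplicity_local_minima
    (p : Polynomial ℝ) (hp : 1 ≤ p.natDegree)
    (f : ℝ → ℝ) (hf_cont : Continuous f) (hf_nonneg : ∀ x, 0 ≤ f x)
    (hf_int : ∫ x : ℝ, f x = 1)
    (δ₀ : ℝ) (l : ℕ) (hl : 2 ≤ l) (r : Fin l → ℝ) (hmono : StrictMono r)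
    (hroots : ∀ i : Fin l, p.eval (r i) = δ₀)
    (heven : ∀ i : Fin l, ∃ m : ℕ, Even m ∧
      (X - C (r i)) ^ m ∣ (p - C δ₀) ∧ ¬ (X - C (r i)) ^ (m + 1) ∣ (p - C δ₀))
    (hmin : ∀ i : Fin l, ∃ η > (0 : ℝ), ∀ x : ℝ, x ≠ r i → |x - r i| < η → δ₀ < p.eval x)
    (hsimple : ∀ x : ℝ, p.eval x = δ₀ → (∀ i : Fin l, x ≠ r i) → (derivative p).eval x ≠ 0)
    (hpos : ∃ i : Fin l, 0 < f (r i)) :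
    IsRiskCriticalPoint (thresholdRisk f p) δ₀ := by
  rintro ⟨N, hN, K, hK⟩
  obtain ⟨i, hi⟩ := hpos
  obtain ⟨η, hη, hmin⟩ := hmin i
  have hr := hroots i
  generalize r i = a at *
  have hfint : Integrable f := by
    by_contra h
    rw [integral_undef h] at hf_int
    exact zero_ne_one hf_int
  set ν : Measure ℝ := volume.withDensity fun x => ENNReal.ofReal (f x) with hν
  have hfin : IsFiniteMeasure ν := isFiniteMeasure_withDensity_ofReal hfint.2
  set c : ℝ := f a / 2 with hc
  have hc0 : 0 < c := by positivity
  set κ : ℝ := c / (|K| + 1) with hκ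
  have hκ0 : 0 < κ := by positivity
  have hle : ∀ x, |x - a| < η → δ₀ ≤ p.eval x := by
    intro x hx
    by_cases h : x = a
    · rw [h, hr]
    · exact (hmin x h hx).le
  have hlocmin : IsLocalMin (fun x => p.eval x) a := by
    filter_upwards [Metric.ball_mem_nhds a hη] with x hx
    rw [hr]
    exact hle x (by simpa [Real.dist_eq] using hx)
  have hder : HasDerivAt (fun x => p.eval x) 0 a := by
    have h := p.hasDerivAt a
    rwa [hlocmin.hasDerivAt_eq_zero h] at h
  have hlin : ∀ᶠ x in nhds a, |p.eval x - δ₀| ≤ κ * |x - a| := by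
    have h := hder.isLittleO.def hκ0
    filter_upwards [h] with x hx
    simpa [hr] using hx
  have hfc : ∀ᶠ x in nhds a, c < f x :=
    hf_cont.continuousAt.eventually (lt_mem_nhds (by linarith))
  obtain ⟨ρ, hρ, hρ'⟩ := Metric.eventually_nhds_iff.1 (hlin.and hfc)
  obtain ⟨τ, hτ, hτ'⟩ := Metric.mem_nhds_iff.1 hN
  obtain ⟨ε, hε, hε'⟩ : ∃ ε > 0, ε < min τ (κ * min ρ η) :=
    exists_between (by positivity)
  have hετ : ε < τ := hε'.trans_le (min_le_left _ _)
  have hεκ : ε / κ < min ρ η := by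
    rw [div_lt_iff₀ hκ0, mul_comm]
    exact hε'.trans_le (min_le_right _ _)
  have hq := hK (δ₀ + ε) (hτ' (by simpa [Real.dist_eq, abs_of_pos hε] using hετ)) (by linarith)
  set B : Set ℝ := Metric.ball a (ε / κ) with hB
  have hBmem : ∀ x ∈ B, |x - a| < ε / κ := fun x hx => by simpa [hB, Real.dist_eq] using hx
  have hBν : ENNReal.ofReal (c * (2 * (ε / κ))) ≤ ν B := by
    rw [hν, withDensity_apply _ Metric.isOpen_ball.measurableSet, ENNReal.ofReal_mul hc0.le,
      ← Real.volume_ball, ← setLIntegral_const]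
    refine setLIntegral_mono' Metric.isOpen_ball.measurableSet fun x hx => ?_
    refine ENNReal.ofReal_le_ofReal (hρ' ?_).2.le
    rw [Real.dist_eq]
    exact (hBmem x hx).trans (hεκ.trans_le (min_le_left _ _))
  have hBν' : c * (2 * (ε / κ)) ≤ ν.real B :=
    (ENNReal.ofReal_le_iff_le_toReal (measure_ne_top _ _)).1 hBν
  have hdisj : Disjoint {x : ℝ | p.eval x < δ₀} B := by
    rw [Set.disjoint_left]
    intro x hx hxB
    exact absurd hx (not_lt.2 (hle x ((hBmem x hxB).trans (hεκ.trans_le (min_le_right _ _)))))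
  have hsub : {x : ℝ | p.eval x < δ₀} ∪ B ⊆ {x : ℝ | p.eval x < δ₀ + ε} := by
    rintro x (hx | hx)
    · have h0 : p.eval x < δ₀ := hx
      show p.eval x < δ₀ + ε
      linarith
    · have h1 := hBmem x hx
      have h2 := (hρ' (y := x) (by
        rw [Real.dist_eq]; exact h1.trans (hεκ.trans_le (min_le_left _ _)))).1
      rw [lt_div_iff₀ hκ0] at h1
      have h3 := le_abs_self (p.eval x - δ₀)
      show p.eval x < δ₀ + ε
      linarith
  have hmain : ν.real {x : ℝ | p.eval x < δ₀} + ν.real B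
      ≤ ν.real {x : ℝ | p.eval x < δ₀ + ε} := by
    rw [← measureReal_union hdisj Metric.isOpen_ball.measurableSet]
    exact measureReal_mono hsub
  have hR : c * (2 * (ε / κ)) ≤ |thresholdRisk f p (δ₀ + ε) - thresholdRisk f p δ₀| := by
    refine le_trans ?_ (le_abs_self _)
    change _ ≤ ν.real {x : ℝ | p.eval x < δ₀ + ε} - ν.real {x : ℝ | p.eval x < δ₀}
    linarith
  rw [add_sub_cancel_left, abs_of_pos hε, div_le_iff₀ hε] at hq
  have hval : c * (2 * (ε / κ)) = 2 * (|K| + 1) * ε := by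
    rw [hκ]
    field_simp
  rw [hval] at hR
  have hfinal := le_of_mul_le_mul_right (hR.trans hq) hε
  have := le_abs_self K
  have := abs_nonneg K
  linarith
end

section
/- Let p, q ∈ ℝ[X] with deg p = n, deg q = m, m > n, and leading coefficient q_m ≠ 0, and let H = p(X) − T·q(X) ∈ (ℝ[T])[X], which has degree m in X with leading coefficient −q_m T. Then the resultant Res_{m, m−1}(H, ∂H/∂X) ∈ ℝ[T] has degree at most 2m − 1 in T, it is divisible by T in ℝ[T], and the quotient Res_{m, m−1}(H, ∂H/∂X)/T has degree at most 2m − 2 in T (so the discriminant of H is a polynomial in T of degree at most 2m − 2). -/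
open Polynomial

/-- The δ-perturbed polynomial `H = p(X) - T·q(X)`, as an element of `(ℝ[T])[X]`:
its coefficients are the polynomials `pᵢ - qᵢ T` in the indeterminate `T`. -/
noncomputable def perturbedBy (p q : Polynomial ℝ) : Polynomial (Polynomial ℝ) :=
  p.map (C : ℝ →+* Polynomial ℝ) - C (X : Polynomial ℝ) * q.map (C : ℝ →+* Polynomial ℝ)

theorem perturbedBy_coeff' (p q : Polynomial ℝ) (k : ℕ) :
    (perturbedBy p q).coeff k = C (p.coeff k) - X * C (q.coeff k) := by
  simp [perturbedBy]

theorem perturbedBy_coeff_natDegree_le (p q : Polynomial ℝ) (k : ℕ) :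
    ((perturbedBy p q).coeff k).natDegree ≤ 1 := by
  rw [perturbedBy_coeff']
  compute_degree

theorem perturbedBy_deriv_coeff_natDegree_le (p q : Polynomial ℝ) (k : ℕ) :
    ((derivative (perturbedBy p q)).coeff k).natDegree ≤ 1 := by
  rw [coeff_derivative, perturbedBy_coeff']
  have h : ((k : Polynomial ℝ) + 1) = C ((k : ℝ) + 1) := by simp
  rw [h]
  compute_degree

theorem det_natDegree_le_of_entries {N : ℕ} (M : Matrix (Fin N) (Fin N) (Polynomial ℝ))
    (h : ∀ i j, (M i j).natDegree ≤ 1) : M.det.natDegree ≤ N := by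
  rw [Matrix.det_apply]
  refine natDegree_sum_le_of_forall_le _ _ fun σ _ => ?_
  refine (natDegree_smul_le _ _).trans ?_
  refine (natDegree_prod_le _ _).trans ?_
  refine (Finset.sum_le_sum fun i _ => h (σ i) i).trans ?_
  simp

theorem dvd_det_of_column {N : ℕ} (M : Matrix (Fin N) (Fin N) (Polynomial ℝ)) (a : Polynomial ℝ)
    (j : Fin N) (h : ∀ i, a ∣ M i j) : a ∣ M.det := by
  rw [Matrix.det_apply']
  refine Finset.dvd_sum fun σ _ => Dvd.dvd.mul_left ?_ _
  exact (h (σ j)).trans (Finset.dvd_prod_of_mem (fun i => M (σ i) i) (Finset.mem_univ j))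

/-- **Hidden polynomial, case `m > n`.** If `deg p = n < m = deg q` with `q_m ≠ 0`, then
`H = p - T·q` has degree `m` in `X` with leading coefficient `-q_m T`, the resultant
`Res_{m,m-1}(H, ∂H/∂X)` has degree at most `2m - 1` in `T`, it is divisible by `T`, and the
quotient has degree at most `2m - 2` in `T` (so the discriminant of `H` is a polynomial in
`T` of degree at most `2m - 2`). -/
theorem hidden_polynomial_degree_case_m_gt_n
    (p q : Polynomial ℝ) (n m : ℕ) (hpn : p.natDegree = n) (hqm : q.natDegree = m)
    (hnm : n < m) (hlead : q.coeff m ≠ 0) :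
    (perturbedBy p q).natDegree = m ∧
    (perturbedBy p q).coeff m = -(C (q.coeff m) * X) ∧
    (resultantAux m (m - 1) (perturbedBy p q)
        (derivative (perturbedBy p q))).natDegree ≤ 2 * m - 1 ∧
    ∃ S : Polynomial ℝ,
      resultantAux m (m - 1) (perturbedBy p q) (derivative (perturbedBy p q)) = X * S ∧
      S.natDegree ≤ 2 * m - 2 := by
  have hp0 : ∀ k, n < k → p.coeff k = 0 := fun k hk =>
    coeff_eq_zero_of_natDegree_lt (by omega)
  have hq0 : ∀ k, m < k → q.coeff k = 0 := fun k hk =>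
    coeff_eq_zero_of_natDegree_lt (by omega)
  have hc : (perturbedBy p q).coeff m = -(C (q.coeff m) * X) := by
    rw [perturbedBy_coeff', hp0 m hnm]
    rw [C_0, zero_sub, mul_comm]
  have hX : (X : Polynomial ℝ) ∣ (perturbedBy p q).coeff m := by
    rw [hc]
    exact (dvd_neg).2 (dvd_mul_left _ _)
  have hdeg : (resultantAux m (m - 1) (perturbedBy p q)
        (derivative (perturbedBy p q))).natDegree ≤ 2 * m - 1 := by
    refine (det_natDegree_le_of_entries _ fun i j => ?_).trans (by omega)
    simp only [sylvesterMatrix, Matrix.of_apply]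
    split_ifs
    · exact perturbedBy_coeff_natDegree_le _ _ _
    · simp
    · exact perturbedBy_deriv_coeff_natDegree_le _ _ _
    · simp
  have hdvd : (X : Polynomial ℝ) ∣ resultantAux m (m - 1) (perturbedBy p q)
        (derivative (perturbedBy p q)) := by
    refine dvd_det_of_column _ _ ⟨0, by omega⟩ fun i => ?_
    simp only [sylvesterMatrix, Matrix.of_apply]
    split_ifs with h1 h2 h2
    · have : m + (i : ℕ) - 0 = m := by omega
      rw [this]
      exact hX
    · exact dvd_zero _
    · have : m - 1 + ((i : ℕ) - (m - 1)) - 0 = m - 1 := by omega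
      rw [this, coeff_derivative, Nat.sub_add_cancel (by omega)]
      exact Dvd.dvd.mul_right hX _
    · exact dvd_zero _
  refine ⟨?_, hc, hdeg, ?_⟩
  · refine natDegree_eq_of_le_of_coeff_ne_zero ?_ ?_
    · rw [natDegree_le_iff_coeff_eq_zero]
      intro k hk
      rw [perturbedBy_coeff', hp0 k (by omega), hq0 k hk]
      simp
    · rw [hc]
      simpa using hlead
  · obtain ⟨S, hS⟩ := hdvd
    refine ⟨S, hS, ?_⟩
    by_cases h0 : S = 0
    · simp [h0]
    · rw [hS, natDegree_X_mul h0] at hdeg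
      omega
end

section
/- Let δ₀ ∈ ℝ and suppose every real root of p − δ₀ is simple (for all r ∈ ℝ, p(r) = δ₀ implies p'(r) ≠ 0). Then the threshold risk function R is differentiable at δ₀ and R'(δ₀) = Σ_{r ∈ ℝ, p(r) = δ₀} f(r)/|p'(r)|, where the (finite) sum runs over all real roots of p − δ₀. -/
open Polynomial MeasureTheory

open Set Filter Topology

lemma thresholdRisk_eq_integral (f : ℝ → ℝ) (p : Polynomial ℝ) (hf : Continuous f)
    (h0 : ∀ x, 0 ≤ f x) (δ : ℝ) :
    thresholdRisk f p δ = ∫ x in {x : ℝ | p.eval x < δ}, f x := by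
  have hm : MeasurableSet {x : ℝ | p.eval x < δ} :=
    (isOpen_lt p.continuous continuous_const).measurableSet
  unfold thresholdRisk
  rw [withDensity_apply _ hm, integral_eq_lintegral_of_nonneg_ae
    (Eventually.of_forall h0) hf.aestronglyMeasurable]

lemma local_deriv (p : Polynomial ℝ) (f : ℝ → ℝ) (hf : Continuous f) (r δ₀ : ℝ)
    (hr : p.eval r = δ₀) (hd : (derivative p).eval r ≠ 0) :
    ∀ᶠ ε in 𝓝[>] (0 : ℝ), HasDerivAt
      (fun δ => ∫ x in {x : ℝ | p.eval x < δ} ∩ Ioo (r - ε) (r + ε), f x)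
      (f r / |(derivative p).eval r|) δ₀ := by
  have hs : HasStrictDerivAt (fun x => p.eval x) ((derivative p).eval r) r :=
    p.hasStrictDerivAt r
  obtain ⟨g, hg0, hgd, hgr⟩ : ∃ g : ℝ → ℝ, g δ₀ = r ∧
      HasDerivAt g ((derivative p).eval r)⁻¹ δ₀ ∧ ∀ᶠ δ in 𝓝 δ₀, p.eval (g δ) = δ := by
    refine ⟨hs.localInverse _ _ _ hd, ?_, ?_, ?_⟩
    · have := (hs.hasStrictFDerivAt_equiv hd).localInverse_apply_image
      simpa [hr] using this
    · have := (hs.to_localInverse hd).hasDerivAt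
      simpa [hr] using this
    · have := (hs.hasStrictFDerivAt_equiv hd).eventually_right_inverse
      simpa [hr] using this
  have hnhds : ∀ P : ℝ → Prop, (∀ᶠ x in 𝓝 r, P x) →
      ∀ᶠ ε in 𝓝[>] (0 : ℝ), ∀ x ∈ Ioo (r - ε) (r + ε), P x := by
    intro P hP
    obtain ⟨η, hη, h⟩ := Metric.eventually_nhds_iff.1 hP
    filter_upwards [Ioo_mem_nhdsGT hη] with ε hε x hx
    apply h
    rw [Real.dist_eq, abs_lt]
    constructor <;> linarith [hx.1, hx.2, hε.2]
  have hgU : ∀ ε > 0, ∀ᶠ δ in 𝓝 δ₀, g δ ∈ Ioo (r - ε) (r + ε) := by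
    intro ε hε
    apply hgd.continuousAt.eventually_mem
    rw [hg0]
    exact Ioo_mem_nhds (by linarith) (by linarith)
  have hdc : ContinuousAt (fun x => (derivative p).eval x) r := (derivative p).continuousAt
  have hint : ∀ a b, IntervalIntegrable f volume a b := fun a b => hf.intervalIntegrable a b
  rcases lt_or_gt_of_ne hd with hneg | hpos
  · filter_upwards [hnhds _ (hdc.eventually_lt continuousAt_const hneg),
      self_mem_nhdsWithin] with ε hε hε0
    have hmono : StrictAntiOn (fun x => p.eval x) (Ioo (r - ε) (r + ε)) := by
      apply strictAntiOn_of_deriv_neg (convex_Ioo _ _) p.continuous.continuousOn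
      intro x hx
      rw [interior_Ioo] at hx
      simpa using hε x hx
    have hD : HasDerivAt (fun δ => ∫ x in (g δ)..(r + ε), f x)
        (f r / |(derivative p).eval r|) δ₀ := by
      have h1 : HasDerivAt (fun u => ∫ x in u..(r + ε), f x) (-f r) (g δ₀) := by
        rw [hg0]
        exact intervalIntegral.integral_hasDerivAt_left (hint _ _)
          (hf.stronglyMeasurableAtFilter _ _) hf.continuousAt
      have h2 := h1.comp δ₀ hgd
      have h3 : f r / |(derivative p).eval r| = -f r * ((derivative p).eval r)⁻¹ := by
        rw [abs_of_neg hneg, div_eq_mul_inv, inv_neg, mul_neg, neg_mul]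
      rw [h3]
      exact h2
    refine hD.congr_of_eventuallyEq ?_
    filter_upwards [hgr, hgU ε hε0] with δ h1 h2
    rw [intervalIntegral.integral_of_le h2.2.le, integral_Ioc_eq_integral_Ioo]
    congr 2
    ext x
    simp only [mem_inter_iff, mem_ofPred_eq, mem_Ioo]
    constructor
    · rintro ⟨ha, hb⟩
      refine ⟨?_, hb.2⟩
      rw [← h1] at ha
      exact (hmono.lt_iff_gt hb h2).1 ha
    · rintro ⟨ha, hb⟩
      have hx : x ∈ Ioo (r - ε) (r + ε) := ⟨h2.1.trans ha, hb⟩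
      refine ⟨?_, hx⟩
      rw [← h1]
      exact hmono h2 hx ha
  · filter_upwards [hnhds _ (continuousAt_const.eventually_lt hdc hpos),
      self_mem_nhdsWithin] with ε hε hε0
    have hmono : StrictMonoOn (fun x => p.eval x) (Ioo (r - ε) (r + ε)) := by
      apply strictMonoOn_of_deriv_pos (convex_Ioo _ _) p.continuous.continuousOn
      intro x hx
      rw [interior_Ioo] at hx
      simpa using hε x hx
    have hD : HasDerivAt (fun δ => ∫ x in (r - ε)..(g δ), f x)
        (f r / |(derivative p).eval r|) δ₀ := by
      have h1 : HasDerivAt (fun u => ∫ x in (r - ε)..u, f x) (f r) (g δ₀) := by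
        rw [hg0]
        exact intervalIntegral.integral_hasDerivAt_right (hint _ _)
          (hf.stronglyMeasurableAtFilter _ _) hf.continuousAt
      have h2 := h1.comp δ₀ hgd
      have h3 : f r / |(derivative p).eval r| = f r * ((derivative p).eval r)⁻¹ := by
        rw [abs_of_pos hpos, div_eq_mul_inv]
      rw [h3]
      exact h2
    refine hD.congr_of_eventuallyEq ?_
    filter_upwards [hgr, hgU ε hε0] with δ h1 h2
    rw [intervalIntegral.integral_of_le h2.1.le, integral_Ioc_eq_integral_Ioo]
    congr 2
    ext x
    simp only [mem_inter_iff, mem_ofPred_eq, mem_Ioo]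
    constructor
    · rintro ⟨ha, hb⟩
      refine ⟨hb.1, ?_⟩
      rw [← h1] at ha
      exact (hmono.lt_iff_lt hb h2).1 ha
    · rintro ⟨ha, hb⟩
      have hx : x ∈ Ioo (r - ε) (r + ε) := ⟨ha, hb.trans h2.2⟩
      refine ⟨?_, hx⟩
      rw [← h1]
      exact hmono hx h2 hb

lemma away_const (p : Polynomial ℝ) (hp : 1 ≤ p.natDegree) (δ₀ : ℝ) (U : Set ℝ) (hU : IsOpen U)
    (h : ∀ x, p.eval x = δ₀ → x ∈ U) :
    ∀ᶠ δ in 𝓝 δ₀, {x : ℝ | p.eval x < δ} \ U = {x : ℝ | p.eval x < δ₀} \ U := by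
  have hprop : IsProperMap (fun x => p.eval x) :=
    p.isProperMap_eval (natDegree_pos_iff_degree_pos.1 hp)
  have hcl := hprop.isClosedMap _ hU.isClosed_compl
  have hmem : ((fun x => p.eval x) '' Uᶜ)ᶜ ∈ 𝓝 δ₀ := by
    apply hcl.isOpen_compl.mem_nhds
    rintro ⟨x, hx, hx2⟩
    exact hx (h x hx2)
  obtain ⟨η, hη, hb⟩ := Metric.mem_nhds_iff.1 hmem
  filter_upwards [Metric.ball_mem_nhds δ₀ hη] with δ hδ
  ext x
  simp only [Set.mem_sdiff, mem_ofPred_eq, and_congr_left_iff]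
  intro hx
  have hx2 : p.eval x ∉ Metric.ball δ₀ η := fun hh => hb hh ⟨x, hx, rfl⟩
  rw [Real.ball_eq_Ioo, mem_Ioo] at hδ hx2
  constructor
  · intro h1
    by_contra h2
    exact hx2 ⟨by linarith, by linarith⟩
  · intro h1
    by_contra h2
    exact hx2 ⟨by linarith, by linarith⟩

/-- If every real root of `p - δ₀` is simple, then the threshold risk function is
differentiable at `δ₀` with derivative `∑ f(r)/|p'(r)|`, the (finite) sum running over all
real roots `r` of `p - δ₀`. -/
theorem hasDerivAt_thresholdRisk_of_simple_roots
    (p : Polynomial ℝ) (hp : 1 ≤ p.natDegree)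
    (f : ℝ → ℝ) (hf_cont : Continuous f) (hf_nonneg : ∀ x, 0 ≤ f x)
    (hf_int : ∫ x : ℝ, f x = 1)
    (δ₀ : ℝ) (hsimple : ∀ r : ℝ, p.eval r = δ₀ → (derivative p).eval r ≠ 0) :
    HasDerivAt (thresholdRisk f p)
      (∑ r ∈ (p - C δ₀).roots.toFinset, f r / |(derivative p).eval r|) δ₀ := by
  have hi : Integrable f := Integrable.of_integral_ne_zero (by rw [hf_int]; exact one_ne_zero)
  have hne : p - C δ₀ ≠ 0 := by
    intro h
    rw [sub_eq_zero.1 h] at hp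
    simp at hp
  have hroot : ∀ r, r ∈ (p - C δ₀).roots.toFinset ↔ p.eval r = δ₀ := by
    intro r
    simp [hne, sub_eq_zero]
  generalize (p - C δ₀).roots.toFinset = s at hroot ⊢
  have h1 : ∀ᶠ ε in 𝓝[>] (0 : ℝ), ∀ r ∈ s, HasDerivAt
      (fun δ => ∫ x in {x : ℝ | p.eval x < δ} ∩ Ioo (r - ε) (r + ε), f x)
      (f r / |(derivative p).eval r|) δ₀ :=
    (s.eventually_all).2 fun r hr => local_deriv p f hf_cont r δ₀ ((hroot r).1 hr)
      (hsimple r ((hroot r).1 hr))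
  have h2 : ∀ᶠ ε in 𝓝[>] (0 : ℝ), ∀ r ∈ s, ∀ t ∈ s, r ≠ t → 2 * ε < |r - t| := by
    refine (s.eventually_all).2 fun r hr => (s.eventually_all).2 fun t ht => ?_
    by_cases h : r = t
    · simp [h]
    · have : 0 < |r - t| / 2 := by
        have := abs_pos.2 (sub_ne_zero.2 h)
        linarith
      filter_upwards [Ioo_mem_nhdsGT this] with ε hε _
      linarith [hε.2]
  obtain ⟨ε, ⟨hD, hsep⟩, hε⟩ := ((h1.and h2).and self_mem_nhdsWithin).exists
  have hε : 0 < ε := hε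
  set U : Set ℝ := ⋃ r ∈ s, Ioo (r - ε) (r + ε) with hUdef
  have hU : IsOpen U := isOpen_biUnion fun _ _ => isOpen_Ioo
  have haway := away_const p hp δ₀ U hU (by
    intro x hx
    exact mem_biUnion ((hroot x).2 hx) ⟨by linarith, by linarith⟩)
  have hsum := (HasDerivAt.fun_sum hD).add_const (∫ x in {x : ℝ | p.eval x < δ₀} \ U, f x)
  refine hsum.congr_of_eventuallyEq ?_
  filter_upwards [haway] with δ hδ
  have hm : MeasurableSet {x : ℝ | p.eval x < δ} :=
    (isOpen_lt p.continuous continuous_const).measurableSet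
  rw [thresholdRisk_eq_integral f p hf_cont hf_nonneg, ← hδ,
    ← integral_inter_add_sdiff hU.measurableSet hi.integrableOn]
  congr 1
  rw [hUdef, inter_iUnion₂]
  refine integral_biUnion_finset s (fun r _ => hm.inter measurableSet_Ioo) ?_
    (fun r _ => hi.integrableOn)
  intro r hr t ht hrt
  refine Disjoint.mono inter_subset_right inter_subset_right ?_
  rw [Set.disjoint_left]
  intro x hx hx2
  have := hsep r hr t ht hrt
  have h3 : |r - t| < 2 * ε := by
    rw [abs_lt]
    constructor <;> linarith [hx.1, hx.2, hx2.1, hx2.2]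
  linarith
end
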